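/- Let G = ((S,E),(S₁,S₂)) be a game graph and U ⊆ S. Define R₀ = U and, for i ≥ 0, R_{i+1} = R_i ∪ {s ∈ S₁ | E(s) ∩ R_i ≠ ∅} ∪ {s ∈ S₂ | E(s) ⊆ R_i}. Then ⋃_{i≥0} R_i = Attr₁(U,G) = W₁^G(Reach(U)); that is, the inductively computed union equals the set of states from which player 1 has a strategy to reach U against all strategies of player 2. -/

import Mathlib

open scoped Classical

/-! Framework for two-player games on graphs.

A game graph on a state type `S` is given by an edge relation `E : S → S → Prop`,
the set `S1 : Set S` of player-1 states (player-2 states are `S1ᶜ`), together with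
the assumption that every state has a successor.  To deal uniformly with sub-games,
all notions are relativized to a carrier set `C : Set S` of states (the full game
corresponds to `C = Set.univ`). -/

/-- A (history-dependent) strategy for player 1 in the game with carrier `C`:
given the history `w` (the play so far, excluding the current state) and the
current state `s` (a player-1 state of the game), it chooses a successor of `s`
inside the game. -/
def Strategy1 {S : Type} (C : Set S) (E : S → S → Prop) (S1 : Set S)
    (σ : List S → S → S) : Prop :=
  ∀ w s, s ∈ C → s ∈ S1 → E s (σ w s) ∧ σ w s ∈ C

/-- A (history-dependent) strategy for player 2 in the game with carrier `C`. -/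
def Strategy2 {S : Type} (C : Set S) (E : S → S → Prop) (S1 : Set S)
    (π : List S → S → S) : Prop :=
  ∀ w s, s ∈ C → s ∉ S1 → E s (π w s) ∧ π w s ∈ C

/-- Auxiliary function: the pair (history, current state) after `n` steps of the
play from `s` in which player 1 follows `σ` and player 2 follows `π`. -/
noncomputable def playAux {S : Type} (S1 : Set S) (σ π : List S → S → S) (s : S) :
    ℕ → List S × S
  | 0 => ([], s)
  | n + 1 =>
      let prev := playAux S1 σ π s n
      (prev.1 ++ [prev.2],
        if prev.2 ∈ S1 then σ prev.1 prev.2 else π prev.1 prev.2)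

/-- The unique play `ω(s, σ, π)` starting from `s` in which player 1 follows `σ`
and player 2 follows `π`. -/
noncomputable def play {S : Type} (S1 : Set S) (σ π : List S → S → S) (s : S)
    (n : ℕ) : S :=
  (playAux S1 σ π s n).2

/-- The winning set of player 1 for the objective `Φ` in the game with carrier `C`. -/
def W1 {S : Type} (C : Set S) (E : S → S → Prop) (S1 : Set S)
    (Φ : Set (ℕ → S)) : Set S :=
  {s | s ∈ C ∧ ∃ σ, Strategy1 C E S1 σ ∧
        ∀ π, Strategy2 C E S1 π → play S1 σ π s ∈ Φ}

/-- The winning set of player 2 for the objective `Ψ` in the game with carrier `C`. -/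
def W2 {S : Type} (C : Set S) (E : S → S → Prop) (S1 : Set S)
    (Ψ : Set (ℕ → S)) : Set S :=
  {s | s ∈ C ∧ ∃ π, Strategy2 C E S1 π ∧
        ∀ σ, Strategy1 C E S1 σ → play S1 σ π s ∈ Ψ}

/-- The reachability objective: some state of `T` is visited. -/
def Reach {S : Type} (T : Set S) : Set (ℕ → S) := {ω | ∃ k, ω k ∈ T}

/-- The safety objective: only states of `F` are visited. -/
def Safe {S : Type} (F : Set S) : Set (ℕ → S) := {ω | ∀ k, ω k ∈ F}

/-- The weak-parity objective for player 1: the minimal priority occurring in the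
play is even. -/
def WeakParityEven {S : Type} (p : S → ℕ) : Set (ℕ → S) :=
  {ω | Even (sInf (p '' Set.range ω))}

/-- The weak-parity objective for player 2: the minimal priority occurring in the
play is odd. -/
def WeakParityOdd {S : Type} (p : S → ℕ) : Set (ℕ → S) :=
  {ω | Odd (sInf (p '' Set.range ω))}

/-- The player-1 attractor of `U` in the game with carrier `C`. -/
def Attr1 {S : Type} (C : Set S) (E : S → S → Prop) (S1 : Set S) (U : Set S) :
    Set S :=
  W1 C E S1 (Reach U)

/-- The player-2 attractor of `U` in the game with carrier `C`. -/
def Attr2 {S : Type} (C : Set S) (E : S → S → Prop) (S1 : Set S) (U : Set S) :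
    Set S :=
  W2 C E S1 (Reach U)

/-- The inductive attractor computation for player 1:
`R₀ = U` and `R_{i+1} = R_i ∪ {s ∈ S₁ ∣ E(s) ∩ R_i ≠ ∅} ∪ {s ∈ S₂ ∣ E(s) ⊆ R_i}`. -/
def Rseq {S : Type} (E : S → S → Prop) (S1 : Set S) (U : Set S) : ℕ → Set S
  | 0 => U
  | i + 1 =>
      Rseq E S1 U i ∪ {s | s ∈ S1 ∧ ∃ t ∈ Rseq E S1 U i, E s t} ∪
        {s | s ∉ S1 ∧ ∀ t, E s t → t ∈ Rseq E S1 U i}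

theorem Rseq_mono' {S : Type} (E : S → S → Prop) (S1 U : Set S) :
    Monotone (Rseq E S1 U) :=
  monotone_nat_of_le_succ (fun _ _ hx => Or.inl (Or.inl hx))

theorem play_succ' {S : Type} (S1 : Set S) (σ π : List S → S → S) (s : S) (n : ℕ) :
    play S1 σ π s (n + 1) =
      if play S1 σ π s n ∈ S1 then σ (playAux S1 σ π s n).1 (play S1 σ π s n)
      else π (playAux S1 σ π s n).1 (play S1 σ π s n) := rfl

theorem exists_move1 {S : Type} (E : S → S → Prop) (S1 : Set S) (hE : ∀ s, ∃ t, E s t)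
    (U : Set S) (s : S) : ∃ t, E s t ∧ (s ∈ S1 → s ∉ U → ∀ j, s ∈ Rseq E S1 U (j + 1) →
      t ∈ Rseq E S1 U j) := by
  by_cases h : s ∈ S1 ∧ s ∉ U ∧ ∃ j, s ∈ Rseq E S1 U j
  · obtain ⟨h1, hU, hj⟩ := h
    have hf := Nat.find_spec hj
    have hm : ∀ m, m < Nat.find hj → s ∉ Rseq E S1 U m := fun m hm => Nat.find_min hj hm
    have hle : ∀ j, s ∈ Rseq E S1 U j → Nat.find hj ≤ j := fun j h => Nat.find_min' hj h
    generalize Nat.find hj = i at hf hm hle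
    cases i with
    | zero => exact absurd hf hU
    | succ k =>
      rcases hf with (hf | ⟨_, t, ht, hst⟩) | ⟨hf, _⟩
      · exact absurd hf (hm k (Nat.lt_succ_self k))
      · refine ⟨t, hst, fun _ _ j hj' => ?_⟩
        exact Rseq_mono' E S1 U (Nat.le_of_succ_le_succ (hle _ hj')) ht
      · exact absurd h1 hf
  · obtain ⟨t, ht⟩ := hE s
    exact ⟨t, ht, fun h1 hU j hj => absurd ⟨h1, hU, j + 1, hj⟩ h⟩

theorem exists_move2 {S : Type} [Fintype S] (E : S → S → Prop) (S1 : Set S)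
    (hE : ∀ s, ∃ t, E s t) (U : Set S) (s : S) :
    ∃ t, E s t ∧ (s ∉ S1 → (∀ j, s ∉ Rseq E S1 U j) → ∀ j, t ∉ Rseq E S1 U j) := by
  by_cases h : ∃ t, E s t ∧ ∀ j, t ∉ Rseq E S1 U j
  · obtain ⟨t, ht, hj⟩ := h
    exact ⟨t, ht, fun _ _ => hj⟩
  · obtain ⟨t, ht⟩ := hE s
    refine ⟨t, ht, fun h1 hs => ?_⟩
    exfalso
    have h2 : ∀ t, ∃ j, E s t → t ∈ Rseq E S1 U j := by
      intro t
      by_cases ht : E s t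
      · by_contra hc
        exact h ⟨t, ht, fun j hj => hc ⟨j, fun _ => hj⟩⟩
      · exact ⟨0, fun h => absurd h ht⟩
    choose r hr using h2
    refine hs (Finset.univ.sup r + 1) (Or.inr ⟨h1, fun t ht => ?_⟩)
    exact Rseq_mono' E S1 U (Finset.le_sup (f := r) (Finset.mem_univ t)) (hr t ht)

/-- The inductively computed union `⋃ᵢ Rᵢ` (with `R₀ = U`,
`R_{i+1} = Rᵢ ∪ {s ∈ S₁ ∣ E(s) ∩ Rᵢ ≠ ∅} ∪ {s ∈ S₂ ∣ E(s) ⊆ Rᵢ}`) equals the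
player-1 attractor `Attr₁(U,G) = W₁ᴳ(Reach(U))`. -/
theorem attractor_inductive_characterization {S : Type} [Fintype S]
    (E : S → S → Prop) (S1 : Set S) (hE : ∀ s, ∃ t, E s t) (U : Set S) :
    (⋃ i, Rseq E S1 U i) = Attr1 Set.univ E S1 U ∧
      Attr1 Set.univ E S1 U = W1 Set.univ E S1 (Reach U) := by
  refine ⟨?_, rfl⟩
  ext s
  rw [Set.mem_iUnion]
  constructor
  · rintro ⟨i, hi⟩
    choose f hf hfR using exists_move1 E S1 hE U
    refine ⟨trivial, fun _ s => f s, fun _ s _ _ => ⟨hf s, trivial⟩, fun π hπ => ?_⟩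
    have key : ∀ i n, play S1 (fun _ s => f s) π s n ∈ Rseq E S1 U i →
        ∃ k, play S1 (fun _ s => f s) π s k ∈ U := by
      intro i
      induction i with
      | zero => exact fun n hn => ⟨n, hn⟩
      | succ i ih =>
        intro n hn
        by_cases hU : play S1 (fun _ s => f s) π s n ∈ U
        · exact ⟨n, hU⟩
        have hs := play_succ' S1 (fun _ s => f s) π s n
        by_cases h1 : play S1 (fun _ s => f s) π s n ∈ S1
        · rw [if_pos h1] at hs
          apply ih (n + 1)
          rw [hs]
          exact hfR _ h1 hU i hn
        · rw [if_neg h1] at hs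
          rcases hn with (hn | ⟨h, _⟩) | ⟨_, hn⟩
          · exact ih n hn
          · exact absurd h h1
          · apply ih (n + 1)
            rw [hs]
            exact hn _ (hπ _ _ trivial h1).1
    exact key i 0 hi
  · rintro ⟨-, σ, hσ, hw⟩
    by_contra hs
    push Not at hs
    choose g hg hgR using exists_move2 E S1 hE U
    obtain ⟨k, hk⟩ := hw (fun _ s => g s) (fun _ s _ _ => ⟨hg s, trivial⟩)
    have key : ∀ n j, play S1 σ (fun _ s => g s) s n ∉ Rseq E S1 U j := by
      intro n
      induction n with
      | zero => exact hs
      | succ n ih =>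
        have hp := play_succ' S1 σ (fun _ s => g s) s n
        by_cases h1 : play S1 σ (fun _ s => g s) s n ∈ S1
        · rw [if_pos h1] at hp
          intro j hj
          rw [hp] at hj
          exact ih (j + 1) (Or.inl (Or.inr ⟨h1, _, hj, (hσ _ _ trivial h1).1⟩))
        · rw [if_neg h1] at hp
          rw [hp]
          exact hgR _ h1 ih
    exact key k 0 hk
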